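/- arXiv:2411.04673 — 4 statements merged into one kernel-verified Lean document; each statement's English description precedes it below -/
import Mathlib

section
/- Let K be a field, let d ≥ 2 be an integer, let x0, x1 ∈ K, let f_0, …, f_d ∈ K and let z_1, …, z_d ∈ K. Let M = M(x0, x1, f) be the (d+1)×(d+1) matrix with M_{i,i} = x1 for 0 ≤ i ≤ d−1, M_{i+1,i} = −x0 for 0 ≤ i ≤ d−1, M_{i,d} = f_i, all other entries 0, and let N = N(z, f) be the (d+1)×3 matrix whose rows are (0, z_1, f_0), (−z_i, z_{i+1}, f_i) for 1 ≤ i ≤ d−1, and (−z_d, 0, f_d). If M·(z_1, …, z_d, 1)ᵀ = 0, then the third column of N equals −x0 times its first column plus −x1 times its second column; consequently rank N ≤ 2 and every 3×3 minor of N vanishes. -/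
/-- The `(d+1) × (d+1)` matrix `M(x0, x1, f)` with `x1` on the diagonal entries
`(i, i)` for `0 ≤ i ≤ d - 1`, `-x0` on the subdiagonal entries `(i+1, i)` for
`0 ≤ i ≤ d - 1`, last column given by `f`, and all other entries zero. -/
def Mmat {K : Type*} [Field K] (d : ℕ) (x0 x1 : K) (f : Fin (d + 1) → K) :
    Matrix (Fin (d + 1)) (Fin (d + 1)) K :=
  Matrix.of fun i j =>
    if (j : ℕ) = d then f i
    else if i = j then x1
    else if (i : ℕ) = (j : ℕ) + 1 then -x0
    else 0

/-- Extension of `z : Fin d → K` (with `z ⟨j⟩ = z_{j+1}` in 1-based notation) by zero. -/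
def zext {K : Type*} [Field K] (d : ℕ) (z : Fin d → K) : ℕ → K :=
  fun n => if h : n < d then z ⟨n, h⟩ else 0

/-- The `(d+1) × 3` matrix `N(z, f)` with rows `(0, z_1, f_0)`,
`(-z_i, z_{i+1}, f_i)` for `1 ≤ i ≤ d - 1`, and `(-z_d, 0, f_d)`. -/
def Nmat {K : Type*} [Field K] (d : ℕ) (z : Fin d → K) (f : Fin (d + 1) → K) :
    Matrix (Fin (d + 1)) (Fin 3) K :=
  Matrix.of fun i j =>
    if j = 0 then (if (i : ℕ) = 0 then 0 else -zext d z ((i : ℕ) - 1))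
    else if j = 1 then zext d z (i : ℕ)
    else f i

theorem zext_eq_sum {K : Type*} [Field K] (d : ℕ) (z : Fin d → K) (n : ℕ) :
    zext d z n = ∑ j : Fin d, if n = (j : ℕ) then z j else 0 := by
  unfold zext
  split_ifs with h
  · rw [Finset.sum_eq_single (⟨n, h⟩ : Fin d)]
    · simp
    · intro b _ hb
      rw [if_neg]
      intro h'
      exact hb (Fin.ext h'.symm)
    · simp
  · symm
    apply Finset.sum_eq_zero
    intro j _
    rw [if_neg]
    have := j.2
    omega

theorem Mmat_row {K : Type*} [Field K] (d : ℕ)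
    (x0 x1 : K) (f : Fin (d + 1) → K) (z : Fin d → K) (i : Fin (d + 1)) :
    (Mmat d x0 x1 f).mulVec (Fin.snoc z 1) i =
      x1 * zext d z i + -x0 * (if (i : ℕ) = 0 then 0 else zext d z ((i : ℕ) - 1)) + f i := by
  have h2 : (if (i : ℕ) = 0 then 0 else zext d z ((i : ℕ) - 1)) =
      ∑ j : Fin d, if (i : ℕ) = (j : ℕ) + 1 then z j else 0 := by
    split_ifs with h
    · symm
      apply Finset.sum_eq_zero
      intro j _
      rw [if_neg]
      omega
    · rw [zext_eq_sum]
      apply Finset.sum_congr rfl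
      intro j _
      have : ((i : ℕ) - 1 = (j : ℕ)) ↔ ((i : ℕ) = (j : ℕ) + 1) := by omega
      simp only [this]
  rw [h2, zext_eq_sum, Finset.mul_sum, Finset.mul_sum, ← Finset.sum_add_distrib]
  simp only [Matrix.mulVec, dotProduct]
  rw [Fin.sum_univ_castSucc]
  congr 1
  · apply Finset.sum_congr rfl
    intro j _
    have hj : (j : ℕ) ≠ d := j.2.ne
    simp only [Mmat, Matrix.of_apply, Fin.snoc_castSucc, Fin.val_castSucc, if_neg hj, Fin.ext_iff]
    by_cases h1 : (i : ℕ) = j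
    · have : ¬ ((i : ℕ) = (j : ℕ) + 1) := by omega
      rw [if_pos h1, if_pos h1, if_neg this]
      ring
    · rw [if_neg h1, if_neg h1]
      split_ifs <;> ring
  · simp [Mmat]

/-- If `M(x0, x1, f) · (z_1, …, z_d, 1)ᵀ = 0`, then the third column of `N(z, f)` is
`-x0` times its first column plus `-x1` times its second column; hence `rank N ≤ 2`
and every `3 × 3` minor of `N` vanishes. -/
theorem Nmat_of_Mmat_kernel {K : Type*} [Field K] (d : ℕ) (hd : 2 ≤ d)
    (x0 x1 : K) (f : Fin (d + 1) → K) (z : Fin d → K)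
    (h : (Mmat d x0 x1 f).mulVec (Fin.snoc z 1) = 0) :
    (∀ i : Fin (d + 1),
        Nmat d z f i 2 = -x0 * Nmat d z f i 0 + -x1 * Nmat d z f i 1) ∧
      (Nmat d z f).rank ≤ 2 ∧
      (∀ r : Fin 3 → Fin (d + 1), ((Nmat d z f).submatrix r id).det = 0) := by
  have h1 : ∀ i : Fin (d + 1),
      Nmat d z f i 2 = -x0 * Nmat d z f i 0 + -x1 * Nmat d z f i 1 := by
    intro i
    have hi := congrFun h i
    rw [Mmat_row] at hi
    simp only [Pi.zero_apply] at hi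
    have e0 : Nmat d z f i 0 = -(if (i : ℕ) = 0 then 0 else zext d z ((i : ℕ) - 1)) := by
      simp only [Nmat, Matrix.of_apply]
      split_ifs <;> simp
    have e1 : Nmat d z f i 1 = zext d z i := by simp [Nmat]
    have e2 : Nmat d z f i 2 = f i := by simp [Nmat]
    rw [e0, e1, e2]
    linear_combination hi
  refine ⟨h1, ?_, ?_⟩
  · have hf : Nmat d z f =
        (Nmat d z f).submatrix id (![0, 1] : Fin 2 → Fin 3) *
          (!![1, 0, -x0; 0, 1, -x1] : Matrix (Fin 2) (Fin 3) K) := by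
      ext i j
      fin_cases j
      · simp [Matrix.mul_apply, Fin.sum_univ_two]
      · simp [Matrix.mul_apply, Fin.sum_univ_two]
      · have := h1 i
        simp [Matrix.mul_apply, Fin.sum_univ_two]
        linear_combination this
    rw [hf]
    refine (Matrix.rank_mul_le_left _ _).trans ?_
    exact Matrix.rank_le_width _
  · intro r
    rw [Matrix.det_fin_three]
    simp only [Matrix.submatrix_apply, id_eq, h1]
    ring
end

section
/- Let K be a field, let d ≥ 2 be an integer, let f_0, …, f_d ∈ K and let z = (z_1, …, z_d) ∈ K^d with z ≠ 0. Let N = N(z, f) be the (d+1)×3 matrix whose rows are (0, z_1, f_0), (−z_i, z_{i+1}, f_i) for 1 ≤ i ≤ d−1, and (−z_d, 0, f_d). Then: (a) the first two columns of N are linearly independent over K (so rank N ≥ 2); (b) if moreover rank N ≤ 2, then there exists a unique pair (x0, x1) ∈ K² such that the third column of N equals −x0 times the first column plus −x1 times the second column, and for this pair the matrix M(x0, x1, f) (with M_{i,i} = x1 for 0 ≤ i ≤ d−1, M_{i+1,i} = −x0 for 0 ≤ i ≤ d−1, M_{i,d} = f_i, other entries 0) satisfies M·(z_1, …, z_d,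 1)ᵀ = 0; in particular det M = 0. -/
theorem zext_sum {K : Type*} [Field K] (d : ℕ) (z : Fin d → K) (n : ℕ) :
    ∑ j : Fin d, (if n = (j : ℕ) then z j else 0) = zext d z n := by
  unfold zext
  split_ifs with h
  · rw [Finset.sum_eq_single (⟨n, h⟩ : Fin d)]
    · simp
    · intro b _ hb
      rw [if_neg]
      intro h'
      exact hb (Fin.ext h'.symm)
    · simp
  · apply Finset.sum_eq_zero
    intro j _
    rw [if_neg]
    have := j.2
    omega

theorem Nmat_key {K : Type*} [Field K] (d : ℕ)
    (f : Fin (d + 1) → K) (z : Fin d → K) (hz : z ≠ 0) (a b : K)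
    (h : ∀ i, a * Nmat d z f i 0 + b * Nmat d z f i 1 = 0) : a = 0 ∧ b = 0 := by
  have hb : b = 0 := by
    by_contra hb
    apply hz
    have hall : ∀ n, n < d → zext d z n = 0 := by
      intro n
      induction n with
      | zero =>
        intro hn
        have := h 0
        simpa [Nmat, hb] using this
      | succ k ih =>
        intro hn
        have := h ⟨k + 1, by omega⟩
        simpa [Nmat, hb, ih (by omega)] using this
    funext j
    simpa [zext] using hall j j.2
  refine ⟨?_, hb⟩
  by_contra ha
  apply hz
  funext j
  have := h j.succ
  simpa [Nmat, hb, ha, zext] using this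

theorem Nmat_mulVec {K : Type*} [Field K] (d : ℕ)
    (f : Fin (d + 1) → K) (z : Fin d → K) (x0 x1 : K)
    (h : ∀ i : Fin (d + 1),
      Nmat d z f i 2 = -x0 * Nmat d z f i 0 + -x1 * Nmat d z f i 1) :
    (Mmat d x0 x1 f).mulVec (Fin.snoc z 1) = 0 := by
  funext i
  have hi := h i
  have h1 : ∀ j : Fin d, Mmat d x0 x1 f i j.castSucc * z j =
      x1 * (if (i : ℕ) = (j : ℕ) then z j else 0) +
      -x0 * (if (i : ℕ) = (j : ℕ) + 1 then z j else 0) := by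
    intro j
    have hj := j.2
    have e : (i = j.castSucc) ↔ (i : ℕ) = (j : ℕ) := by simp [Fin.ext_iff]
    simp only [Mmat, Matrix.of_apply, e, Fin.val_castSucc, hj.ne, if_false]
    by_cases h1 : (i : ℕ) = j
    · have : ¬ (i : ℕ) = (j : ℕ) + 1 := by omega
      simp [h1]
    · simp [h1]
  have h2 : ∑ j : Fin d, (if (i : ℕ) = (j : ℕ) + 1 then z j else 0) =
      -Nmat d z f i 0 := by
    by_cases h0 : (i : ℕ) = 0
    · have h0x : i = 0 := Fin.ext h0
      simp [Nmat, h0x]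
    · simp only [Nmat, Matrix.of_apply, if_true, h0, if_false, neg_neg]
      rw [← zext_sum]
      refine Finset.sum_congr rfl fun j _ => ?_
      have : ((i : ℕ) = (j : ℕ) + 1) ↔ (i : ℕ) - 1 = j := by omega
      simp only [this]
  have h3 : Nmat d z f i 1 = zext d z i := by simp [Nmat]
  have h4 : Nmat d z f i 2 = f i := by simp [Nmat]
  have h5 : Mmat d x0 x1 f i (Fin.last d) = f i := by simp [Mmat]
  simp only [Matrix.mulVec, dotProduct, Fin.sum_univ_castSucc, Fin.snoc_castSucc,
    Fin.snoc_last, h1, Finset.sum_add_distrib, ← Finset.mul_sum, zext_sum, h2, h5,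
    Pi.zero_apply]
  rw [h4, h3] at hi
  rw [hi]
  ring

/-- If `z ≠ 0`, then (a) the first two columns of `N(z, f)` are linearly independent
(so `rank N ≥ 2`); (b) if moreover `rank N ≤ 2`, there is a unique pair `(x0, x1)` such
that the third column of `N` equals `-x0` times the first plus `-x1` times the second,
and for any such pair `M(x0, x1, f) · (z_1, …, z_d, 1)ᵀ = 0`; in particular
`det M(x0, x1, f) = 0`. -/
theorem Mmat_of_Nmat_rank_le_two {K : Type*} [Field K] (d : ℕ) (hd : 2 ≤ d)
    (f : Fin (d + 1) → K) (z : Fin d → K) (hz : z ≠ 0) :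
    (LinearIndependent K
        (fun j : Fin 2 => fun i : Fin (d + 1) => Nmat d z f i j.castSucc)) ∧
      2 ≤ (Nmat d z f).rank ∧
      ((Nmat d z f).rank ≤ 2 →
        (∃! p : K × K, ∀ i : Fin (d + 1),
            Nmat d z f i 2 = -p.1 * Nmat d z f i 0 + -p.2 * Nmat d z f i 1) ∧
        (∀ x0 x1 : K,
          (∀ i : Fin (d + 1),
              Nmat d z f i 2 = -x0 * Nmat d z f i 0 + -x1 * Nmat d z f i 1) →
            (Mmat d x0 x1 f).mulVec (Fin.snoc z 1) = 0 ∧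
              (Mmat d x0 x1 f).det = 0)) := by
  have hli : LinearIndependent K
      (fun j : Fin 2 => fun i : Fin (d + 1) => Nmat d z f i j.castSucc) := by
    rw [Fintype.linearIndependent_iff]
    intro g hg
    have := Nmat_key d f z hz (g 0) (g 1) (fun i => by
      have := congrFun hg i
      simpa [Fin.sum_univ_two] using this)
    intro i
    fin_cases i
    · exact this.1
    · exact this.2
  refine ⟨hli, ?_, ?_⟩
  · rw [Matrix.rank_eq_finrank_span_cols]
    have h2 := finrank_span_eq_card hli
    rw [Fintype.card_fin] at h2
    rw [← h2]
    apply Submodule.finrank_mono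
    apply Submodule.span_mono
    rintro _ ⟨j, rfl⟩
    exact ⟨j.castSucc, rfl⟩
  · intro hr
    refine ⟨?_, ?_⟩
    · have hn : ¬ LinearIndependent K (Nmat d z f).col := by
        intro hl
        have h3 := finrank_span_eq_card hl
        rw [Matrix.rank_eq_finrank_span_cols, h3, Fintype.card_fin] at hr
        omega
      rw [Fintype.not_linearIndependent_iff] at hn
      obtain ⟨g, hg, k, hk⟩ := hn
      have hg' : ∀ i, g 0 * Nmat d z f i 0 + g 1 * Nmat d z f i 1
          + g 2 * Nmat d z f i 2 = 0 := by
        intro i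
        have := congrFun hg i
        simpa [Fin.sum_univ_three] using this
      have h2 : g 2 ≠ 0 := by
        intro h2
        have := Nmat_key d f z hz (g 0) (g 1) (fun i => by simpa [h2] using hg' i)
        apply hk
        fin_cases k
        · exact this.1
        · exact this.2
        · exact h2
      have hex : ∀ i, Nmat d z f i 2 =
          -(g 0 / g 2) * Nmat d z f i 0 + -(g 1 / g 2) * Nmat d z f i 1 := by
        intro i
        have := hg' i
        field_simp
        linear_combination this
      refine ⟨(g 0 / g 2, g 1 / g 2), hex, ?_⟩
      rintro ⟨p, q⟩ hp
      have := Nmat_key d f z hz (p - g 0 / g 2) (q - g 1 / g 2) (fun i => by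
        have h1 := hp i
        have h2 := hex i
        simp only at h1
        linear_combination h1 - h2)
      exact Prod.ext (sub_eq_zero.mp this.1) (sub_eq_zero.mp this.2)
    · intro x0 x1 h
      have hM := Nmat_mulVec d f z x0 x1 h
      refine ⟨hM, ?_⟩
      apply Matrix.exists_mulVec_eq_zero_iff.mp
      refine ⟨_, ?_, hM⟩
      intro h0
      have := congrFun h0 (Fin.last d)
      simp at this
end

section
/- Let K be a field of characteristic zero and let d ≥ 2 be an integer. For m ≥ 0 set q_m(T) = ∑_{j=0}^{m} (T − 1)^j ∈ K[T]. Let Ñ be the (d+1)×3 matrix with entries in the polynomial ring K[z_2, …, z_d] whose rows are (0, 1, 1), (−z_i, z_{i+1}, 1) for 1 ≤ i ≤ d−1 (with the convention z_1 = 1), and (−z_d, 0, 1), and let J ⊆ K[z_2, …, z_d] be the ideal generated by the determinants of all 3×3 submatrices of Ñ. Then the K-algebra homomorphism K[z_2, …, z_d] → K[T]/(q_d) sending z_i to the class of q_{i−1}(T) is surjective with kernel J; i.e. it induces a K-algebra isomorphism K[z_2, …, z_d]/J ≅ K[T]/(q_d). -/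
open Polynomial

/-- The polynomial `q_m(T) = ∑_{j=0}^{m} (T - 1)^j`. -/
noncomputable def qpoly (K : Type*) [Field K] (m : ℕ) : K[X] :=
  ∑ j ∈ Finset.range (m + 1), (X - 1) ^ j

/-- The element `z_j` of `K[z_2, …, z_d]` (variables indexed by `Fin (d-1)`, the
variable of index `i` being `z_{i+2}`), with the convention `z_1 = 1`. -/
noncomputable def zvar (K : Type*) [Field K] (d : ℕ) (j : ℕ) :
    MvPolynomial (Fin (d - 1)) K :=
  if j = 1 then 1
  else if h : j - 2 < d - 1 then MvPolynomial.X ⟨j - 2, h⟩ else 0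

/-- The `(d+1) × 3` matrix `Ñ` over `K[z_2, …, z_d]` with rows `(0, 1, 1)`,
`(-z_i, z_{i+1}, 1)` for `1 ≤ i ≤ d - 1` (with the convention `z_1 = 1`),
and `(-z_d, 0, 1)`. -/
noncomputable def Ntilde (K : Type*) [Field K] (d : ℕ) :
    Matrix (Fin (d + 1)) (Fin 3) (MvPolynomial (Fin (d - 1)) K) :=
  Matrix.of fun i j =>
    if j = 0 then (if (i : ℕ) = 0 then 0 else -zvar K d (i : ℕ))
    else if j = 1 then (if (i : ℕ) = d then 0 else zvar K d ((i : ℕ) + 1))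
    else 1

/-- The ideal of `K[z_2, …, z_d]` generated by the `3 × 3` minors of `Ñ`. -/
noncomputable def minorsIdeal (K : Type*) [Field K] (d : ℕ) :
    Ideal (MvPolynomial (Fin (d - 1)) K) :=
  Ideal.span (Set.range fun r : Fin 3 → Fin (d + 1) => ((Ntilde K d).submatrix r id).det)

/-- The `K`-algebra map `K[z_2, …, z_d] → K[T]/(q_d)` sending `z_i` to the class of
`q_{i-1}(T)`. -/
noncomputable def fibreMap (K : Type*) [Field K] (d : ℕ) :
    MvPolynomial (Fin (d - 1)) K →ₐ[K] K[X] ⧸ Ideal.span {qpoly K d} :=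
  MvPolynomial.aeval fun i : Fin (d - 1) =>
    Ideal.Quotient.mk (Ideal.span {qpoly K d}) (qpoly K ((i : ℕ) + 1))

theorem qpoly_succ_aux (K : Type*) [Field K] (m : ℕ) :
    qpoly K (m + 1) = (X - 1) * qpoly K m + 1 := by
  unfold qpoly
  rw [Finset.sum_range_succ', Finset.mul_sum]
  simp [pow_succ']

theorem qpoly_zero_aux (K : Type*) [Field K] : qpoly K 0 = 1 := by
  simp [qpoly]

theorem qpoly_one_aux (K : Type*) [Field K] : qpoly K 1 = X := by
  rw [qpoly_succ_aux, qpoly_zero_aux]; ring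

theorem fibreMap_zvar_aux (K : Type*) [Field K] (d : ℕ) (j : ℕ) (hj : j ≤ d) :
    fibreMap K d (zvar K d (j + 1)) =
      Ideal.Quotient.mk (Ideal.span {qpoly K d}) (qpoly K j) := by
  unfold zvar
  rcases Nat.eq_zero_or_pos j with rfl | h0
  · simp [qpoly_zero_aux]
  · rw [if_neg (by omega)]
    split_ifs with h
    · have : j - 1 + 1 = j := by omega
      simp [fibreMap, this]
    · have : j = d := by omega
      subst this
      rw [map_zero, eq_comm, Ideal.Quotient.eq_zero_iff_mem]
      exact Ideal.mem_span_singleton_self _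

theorem col_rel_aux (K : Type*) [Field K] (d : ℕ) (hd : 2 ≤ d) (i : Fin (d + 1)) :
    fibreMap K d (Ntilde K d i 2) =
      Ideal.Quotient.mk (Ideal.span {qpoly K d}) (X - 1) * fibreMap K d (Ntilde K d i 0) +
        fibreMap K d (Ntilde K d i 1) := by
  have h1 : Ntilde K d i 1 = zvar K d ((i : ℕ) + 1) := by
    by_cases h : (i : ℕ) = d
    · simp [Ntilde, h, zvar, show d ≠ 0 by omega]
    · simp [Ntilde, h]
  have h2 : Ntilde K d i 2 = 1 := by simp [Ntilde]
  rw [h1, h2, fibreMap_zvar_aux K d i (by omega)]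
  obtain ⟨i, hi⟩ := i
  rcases i with _ | i
  · simp [Ntilde, qpoly_zero_aux]
  · have h0 : Ntilde K d ⟨i + 1, hi⟩ 0 = - zvar K d (i + 1) := by simp [Ntilde]
    rw [h0, map_neg, fibreMap_zvar_aux K d i (by omega), qpoly_succ_aux]
    simp only [map_add, map_mul, map_one]
    ring

theorem minors_rel_aux (K : Type*) [Field K] (d : ℕ) (hd : 2 ≤ d) (j : ℕ) (hj : j ≤ d)
    (h1 : 1 ≤ j) :
    Ideal.Quotient.mk (minorsIdeal K d) (zvar K d (j + 1)) =
      Ideal.Quotient.mk (minorsIdeal K d) ((zvar K d 2 - 1) * zvar K d j + 1) := by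
  have hm : ((Ntilde K d).submatrix ![⟨0, by omega⟩, ⟨1, by omega⟩, ⟨j, by omega⟩] id).det ∈
      minorsIdeal K d := Ideal.subset_span ⟨_, rfl⟩
  have hz : Ntilde K d ⟨j, by omega⟩ 1 = zvar K d (j + 1) := by
    by_cases h : j = d
    · simp [Ntilde, h, zvar, show d ≠ 0 by omega]
    · simp [Ntilde, h]
  have hz0 : Ntilde K d ⟨j, by omega⟩ 0 = - zvar K d j := by
    simp [Ntilde, show j ≠ 0 by omega]
  have hz2 : Ntilde K d ⟨j, by omega⟩ 2 = 1 := by simp [Ntilde]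
  have a0 : Ntilde K d ⟨0, by omega⟩ 0 = 0 := by simp [Ntilde]
  have a1 : Ntilde K d ⟨0, by omega⟩ 1 = 1 := by
    simp [Ntilde, show 0 ≠ d by omega, zvar]
  have a2 : Ntilde K d ⟨0, by omega⟩ 2 = 1 := by simp [Ntilde]
  have b0 : Ntilde K d ⟨1, by omega⟩ 0 = -1 := by simp [Ntilde, zvar]
  have b1 : Ntilde K d ⟨1, by omega⟩ 1 = zvar K d 2 := by
    simp [Ntilde, show 1 ≠ d by omega]
  have b2 : Ntilde K d ⟨1, by omega⟩ 2 = 1 := by simp [Ntilde]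
  rw [Matrix.det_fin_three] at hm
  simp only [Matrix.submatrix_apply, id, Matrix.cons_val_zero, Matrix.cons_val_one,
    Matrix.cons_val, hz, hz0, hz2, a0, a1, a2, b0, b1, b2] at hm
  rw [Ideal.Quotient.eq, ← neg_mem_iff]
  convert hm using 1
  ring

/-- The map `K[z_2, …, z_d] → K[T]/(q_d)`, `z_i ↦ q_{i-1}(T)`, is surjective with
kernel the ideal of `3 × 3` minors of `Ñ`; i.e. it induces a `K`-algebra isomorphism
`K[z_2, …, z_d]/J ≅ K[T]/(q_d)`. -/
theorem fibreMap_surjective_ker (K : Type*) [Field K] [CharZero K] (d : ℕ)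
    (hd : 2 ≤ d) :
    Function.Surjective (fibreMap K d) ∧ RingHom.ker (fibreMap K d) = minorsIdeal K d := by
  have hphi : ∀ p : K[X], fibreMap K d (aeval (zvar K d 2) p) =
      Ideal.Quotient.mk (Ideal.span {qpoly K d}) p := by
    intro p
    have : (fibreMap K d).comp (aeval (zvar K d 2)) =
        Ideal.Quotient.mkₐ K (Ideal.span {qpoly K d}) := by
      apply Polynomial.algHom_ext
      simp [fibreMap_zvar_aux K d 1 (by omega), qpoly_one_aux]
    exact DFunLike.congr_fun this p
  have hq : ∀ j, j ≤ d → Ideal.Quotient.mk (minorsIdeal K d) (zvar K d (j + 1)) =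
      Ideal.Quotient.mk (minorsIdeal K d) (aeval (zvar K d 2) (qpoly K j)) := by
    intro j
    induction j with
    | zero => intro _; simp [qpoly_zero_aux, zvar]
    | succ j ih =>
      intro hj
      rw [minors_rel_aux K d hd (j + 1) hj (by omega), qpoly_succ_aux]
      simp only [map_add, map_mul, map_one, map_sub, aeval_X, ih (by omega)]
  have hqd : aeval (zvar K d 2) (qpoly K d) ∈ minorsIdeal K d := by
    rw [← Ideal.Quotient.eq_zero_iff_mem, ← hq d le_rfl]
    have : zvar K d (d + 1) = 0 := by
      simp [zvar, show d ≠ 0 by omega]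
    rw [this, map_zero]
  have hle : minorsIdeal K d ≤ RingHom.ker (fibreMap K d) := by
    unfold minorsIdeal
    rw [Ideal.span_le]
    rintro _ ⟨r, rfl⟩
    rw [SetLike.mem_coe, RingHom.mem_ker]
    beta_reduce
    rw [Matrix.det_fin_three]
    simp only [Matrix.submatrix_apply, id, map_add, map_sub, map_mul, col_rel_aux K d hd]
    ring
  refine ⟨fun y => ?_, le_antisymm ?_ hle⟩
  · obtain ⟨p, rfl⟩ := Ideal.Quotient.mk_surjective y
    exact ⟨_, hphi p⟩
  · -- every polynomial is congruent mod J to a polynomial in z_2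
    have hrep : ∀ f : MvPolynomial (Fin (d - 1)) K, ∃ p : K[X],
        Ideal.Quotient.mk (minorsIdeal K d) f =
          Ideal.Quotient.mk (minorsIdeal K d) (aeval (zvar K d 2) p) := by
      intro f
      induction f using MvPolynomial.induction_on with
      | C a => exact ⟨C a, by simp [MvPolynomial.algebraMap_eq]⟩
      | add f g hf hg =>
        obtain ⟨p, hp⟩ := hf
        obtain ⟨q, hq⟩ := hg
        exact ⟨p + q, by simp only [map_add, hp, hq]⟩
      | mul_X f i hf =>
        obtain ⟨p, hp⟩ := hf
        refine ⟨p * qpoly K (i + 1), ?_⟩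
        have := hq (i + 1) (by omega)
        have hX : zvar K d ((i : ℕ) + 1 + 1) = MvPolynomial.X i := by
          simp [zvar]
        rw [hX] at this
        simp only [map_mul, hp, this]
    intro f hf
    obtain ⟨p, hp⟩ := hrep f
    have h1 : fibreMap K d (aeval (zvar K d 2) p) = 0 := by
      have := hle (Ideal.Quotient.eq.mp hp)
      rw [RingHom.mem_ker, map_sub, RingHom.mem_ker.mp hf, zero_sub, neg_eq_zero] at this
      exact this
    rw [hphi, Ideal.Quotient.eq_zero_iff_mem, Ideal.mem_span_singleton] at h1
    obtain ⟨r, rfl⟩ := h1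
    rw [← Ideal.Quotient.eq_zero_iff_mem, hp, Ideal.Quotient.eq_zero_iff_mem, map_mul]
    exact Ideal.mul_mem_right _ _ hqd
end

section
/- Let ρ ≥ 2 be an integer, let l_1 ≠ l_2 be two indices in {1, …, ρ}, and for k = 1, 2 let σ_k : ℤ^ρ → ℤ^ρ be the ℤ-linear map defined on the standard basis by σ_k(e_i) = e_i for i ≠ l_k and σ_k(e_{l_k}) = −e_{l_k} + ∑_{i ≠ l_k} a^{(k)}_i e_i, where the integers a^{(k)}_i satisfy a^{(k)}_i ≥ 2 for all i. Then σ_1 and σ_2 are involutions (σ_k ∘ σ_k = id), and the composition σ_1 ∘ σ_2 has infinite order, i.e. (σ_1 ∘ σ_2)^n ≠ id for every integer n ≥ 1. In particular, the subgroup of GL(ℤ^ρ) generated by σ_1 and σ_2 is infinite. -/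
/-- The `ℤ`-linear involution of `ℤ^ρ` fixing `e_i` for `i ≠ l` and sending
`e_l` to `-e_l + ∑_{i ≠ l} a_i e_i`. -/
def latticeInvolution {ρ : ℕ} (l : Fin ρ) (a : Fin ρ → ℤ) :
    Module.End ℤ (Fin ρ → ℤ) where
  toFun v := fun j => if j = l then -v l else v j + a j * v l
  map_add' u v := by
    funext j
    by_cases h : j = l <;> simp [h] <;> ring
  map_smul' c v := by
    funext j
    by_cases h : j = l <;> simp [h] <;> ring

theorem latticeInvolution_sq {ρ : ℕ} (l : Fin ρ) (a : Fin ρ → ℤ) :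
    latticeInvolution l a * latticeInvolution l a = 1 := by
  apply LinearMap.ext
  intro v
  funext j
  by_cases h : j = l <;> simp [latticeInvolution, h]

/-- Two involutions `σ₁, σ₂` of `ℤ^ρ` as above, with distinct special indices
`l₁ ≠ l₂` and all coefficients `≥ 2`, satisfy `σ_k² = id`, while `σ₁ ∘ σ₂` has
infinite order; in particular they generate an infinite subgroup of `GL(ℤ^ρ)`. -/
theorem latticeInvolutions_generate_infinite_group {ρ : ℕ} (hρ : 2 ≤ ρ)
    (l1 l2 : Fin ρ) (hne : l1 ≠ l2) (a1 a2 : Fin ρ → ℤ)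
    (ha1 : ∀ i, i ≠ l1 → 2 ≤ a1 i) (ha2 : ∀ i, i ≠ l2 → 2 ≤ a2 i) :
    latticeInvolution l1 a1 * latticeInvolution l1 a1 = 1 ∧
      latticeInvolution l2 a2 * latticeInvolution l2 a2 = 1 ∧
      (∀ n : ℕ, 1 ≤ n → (latticeInvolution l1 a1 * latticeInvolution l2 a2) ^ n ≠ 1) ∧
      Infinite (Submonoid.closure
        {latticeInvolution l1 a1, latticeInvolution l2 a2} :
          Submonoid (Module.End ℤ (Fin ρ → ℤ))) := by
  set τ := latticeInvolution l1 a1 * latticeInvolution l2 a2 with hτ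
  have hb := ha2 l1 hne
  have ha := ha1 l2 hne.symm
  have e1 : ∀ v, τ v l1 = -(v l1 + a2 l1 * v l2) := by
    intro v
    simp [hτ, latticeInvolution, hne]
  have e2 : ∀ v, τ v l2 = -v l2 + a1 l2 * (v l1 + a2 l1 * v l2) := by
    intro v
    simp [hτ, latticeInvolution, hne, hne.symm]
  have step : ∀ v : Fin ρ → ℤ, 0 ≤ -v l1 → -v l1 < v l2 →
      0 ≤ -τ v l1 ∧ -τ v l1 < τ v l2 ∧ v l2 < τ v l2 := by
    intro v h0 h1
    rw [e1, e2]
    have hX : v l2 < v l1 + a2 l1 * v l2 := by nlinarith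
    generalize v l1 + a2 l1 * v l2 = X at hX
    refine ⟨by linarith, by nlinarith, by nlinarith⟩
  have inv : ∀ n : ℕ, 0 ≤ -(τ ^ n) (Pi.single l2 1) l1 ∧
      -(τ ^ n) (Pi.single l2 1) l1 < (τ ^ n) (Pi.single l2 1) l2 := by
    intro n
    induction n with
    | zero => simp [hne]
    | succ n ih =>
      rw [pow_succ', Module.End.mul_apply]
      obtain ⟨h1, h2, _⟩ := step _ ih.1 ih.2
      exact ⟨h1, h2⟩
  have mono : StrictMono (fun n : ℕ => (τ ^ n) (Pi.single l2 1) l2) := by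
    apply strictMono_nat_of_lt_succ
    intro n
    simp only [pow_succ' τ n, Module.End.mul_apply]
    exact (step _ (inv n).1 (inv n).2).2.2
  have inj : Function.Injective (fun n : ℕ => τ ^ n) := by
    intro m n h
    apply mono.injective
    simp only at h ⊢
    rw [h]
  refine ⟨latticeInvolution_sq _ _, latticeInvolution_sq _ _, ?_, ?_⟩
  · intro n hn h
    have : n = 0 := inj (by simpa using h)
    omega
  · have mem : τ ∈ Submonoid.closure {latticeInvolution l1 a1, latticeInvolution l2 a2} :=
      mul_mem (Submonoid.subset_closure (by simp)) (Submonoid.subset_closure (by simp))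
    exact Infinite.of_injective (fun n : ℕ => ⟨τ ^ n, pow_mem mem n⟩)
      (fun m n h => inj (congrArg Subtype.val h))
end
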